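/- Let k be any field and let σ be the k-automorphism of k(x₀,x₁,...,x₆) defined by σ: x₀ ↦ x₁ ↦ ⋯ ↦ x₆ ↦ x₀ (the 7-cycle permutation of variables). Then the fixed field k(x₀,...,x₆)^⟨σ⟩ is purely transcendental over k. -/

import Mathlib

/-- An intermediate field `L` of `E/k` is purely transcendental (rational) over `k`
if `L = k(s)` for some set `s` of elements algebraically independent over `k`. -/
def IsRationalExtension (k : Type*) {E : Type*} [Field k] [Field E] [Algebra k E]
    (L : IntermediateField k E) : Prop :=
  ∃ s : Set E, AlgebraicIndependent k ((↑) : s → E) ∧ IntermediateField.adjoin k s = L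

open IntermediateField Module
open scoped IntermediateField.algebraAdjoinAdjoin

theorem mem_fixedField_zpowers_iff {k K : Type*} [Field k] [Field K] [Algebra k K]
    (σ : K ≃ₐ[k] K) (z : K) : z ∈ fixedField (Subgroup.zpowers σ) ↔ σ z = z := by
  rw [mem_fixedField_iff]
  refine ⟨fun h ↦ h σ (Subgroup.mem_zpowers σ), fun h τ hτ ↦ ?_⟩
  have : Subgroup.zpowers σ ≤ MulAction.stabilizer (K ≃ₐ[k] K) z := by
    rw [Subgroup.zpowers_le]; exact h
  exact this hτ

theorem orderOf_cyclicShift {k K : Type*} [Field k] [Field K] [Algebra k K]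
    {p : ℕ} [Fact p.Prime] {x : ZMod p → K} (hx : Function.Injective x)
    (hgen : adjoin k (Set.range x) = ⊤)
    {σ : K ≃ₐ[k] K} (hσ : ∀ i, σ (x i) = x (i + 1)) : orderOf σ = p := by
  have hpow (n : ℕ) (i : ZMod p) : (σ ^ n) (x i) = x (i + n) := by
    induction n with
    | zero => simp
    | succ n ih => rw [pow_succ', AlgEquiv.mul_apply, ih, hσ, Nat.cast_succ, add_assoc]
  refine orderOf_eq_prime ?_ fun h ↦ ?_
  · have htop : (⊤ : IntermediateField k K) ≤ fixedField (Subgroup.zpowers (σ ^ p)) := by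
      rw [← hgen, adjoin_le_iff]
      rintro _ ⟨i, rfl⟩
      rw [SetLike.mem_coe, mem_fixedField_zpowers_iff, hpow, CharP.cast_eq_zero, add_zero]
    ext z
    exact (mem_fixedField_zpowers_iff _ _).mp (htop (mem_top (x := z)))
  · have := hσ 0
    rw [h, AlgEquiv.one_apply] at this
    simpa using hx this

/-- If `p` elements fixed by a cyclic shift `σ` of `p` generating variables generate a field over
which `K` has degree less than `2 * p`, then they witness the rationality of the fixed field. -/
theorem isRationalExtension_fixedField_of_finrank_lt
    {k K : Type*} [Field k] [Field K] [Algebra k K] {p : ℕ} [Fact p.Prime]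
    {x : ZMod p → K} (hx : AlgebraicIndependent k x) (hgen : adjoin k (Set.range x) = ⊤)
    {σ : K ≃ₐ[k] K} (hσ : ∀ i, σ (x i) = x (i + 1))
    {w : ZMod p → K} (hw : ∀ i, σ (w i) = w i)
    [FiniteDimensional (adjoin k (Set.range w)) K]
    (hlt : finrank (adjoin k (Set.range w)) K < 2 * p) :
    IsRationalExtension k (fixedField (Subgroup.zpowers σ)) := by
  set F := adjoin k (Set.range w) with hF
  set E := fixedField (Subgroup.zpowers σ) with hE
  have hord := orderOf_cyclicShift hx.injective hgen hσ
  have hle : F ≤ E := by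
    rw [hF, adjoin_le_iff]
    rintro _ ⟨i, rfl⟩
    exact (mem_fixedField_zpowers_iff _ _).mpr (hw i)
  have : Finite (Subgroup.zpowers σ) :=
    Nat.finite_of_card_ne_zero (by rw [Nat.card_zpowers, hord]; exact (Fact.out : p.Prime).ne_zero)
  have hrank : finrank E K = p := by
    have := Fintype.ofFinite (Subgroup.zpowers σ)
    rw [← hord, ← Nat.card_zpowers, Nat.card_eq_fintype_card]
    exact FixedPoints.finrank_eq_card (Subgroup.zpowers σ) K
  have hdvd : p ∣ finrank F K := by
    have : finrank E K ∣ finrank F K := by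
      let := (inclusion hle).toRingHom.toAlgebra
      have : IsScalarTower F E K := IsScalarTower.of_algebraMap_eq (congrFun rfl)
      exact Dvd.intro_left _ (finrank_mul_finrank F E K)
    rwa [hrank] at this
  have hpos : 0 < finrank F K := finrank_pos
  have hFE : F = E := eq_of_le_of_finrank_le' hle <| by
    obtain ⟨m, hm⟩ := hdvd
    rw [hm] at hlt hpos ⊢
    have : m < 2 := lt_of_mul_lt_mul_left (mul_comm p 2 ▸ hlt) (Nat.zero_le p)
    rw [hrank]
    exact (Nat.mul_le_mul_left p (Nat.le_of_lt_succ this)).trans_eq (mul_one p)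
  have halg : Algebra.IsAlgebraic (Algebra.adjoin k (Set.range w)) K :=
    (IsFractionRing.comap_isAlgebraic_iff (K := F)).mpr inferInstance
  have hxalg : Algebra.IsAlgebraic (Algebra.adjoin k (Set.range x)) K := by
    refine (IsFractionRing.comap_isAlgebraic_iff (K := adjoin k (Set.range x))).mpr
      ⟨fun z ↦ isAlgebraic_algebraMap (⟨z, hgen ▸ mem_top⟩ : adjoin k (Set.range x))⟩
  have hbasis := hx.isTranscendenceBasis_iff_isAlgebraic.mpr hxalg
  have hwb := Algebra.IsAlgebraic.isTranscendenceBasis_of_lift_le_trdeg_of_finite k w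
    hbasis.lift_cardinalMk_eq_trdeg.le
  exact ⟨Set.range w, AlgebraicIndependent.to_subtype_range hwb.1, hFE⟩

/-- A linear form in algebraically independent elements with coefficients integral over the base
field, one of them being `1`, is a unit. -/
theorem AlgebraicIndependent.isUnit_sum {k K R ι : Type*} [Field k] [Field K] [CommRing R]
    [Algebra k K] [Algebra K R] [Algebra k R] [IsScalarTower k K R] [Fintype ι]
    {x : ι → K} (hx : AlgebraicIndependent k x) {b : ι → R} (hb : ∀ i, IsIntegral k (b i))
    {i₀ : ι} (hb₀ : b i₀ = 1) : IsUnit (∑ i, algebraMap K R (x i) * b i) := by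
  classical
  set A := Algebra.adjoin k (Set.image x {i₀}ᶜ) with hA
  set n := ∑ i ∈ Finset.univ.erase i₀, algebraMap K R (x i) * b i with hn
  have hint : IsIntegral A (-n) := by
    refine (IsIntegral.sum _ fun i hi ↦ .mul ?_ (hb i).tower_top).neg
    have hxi : x i ∈ A := Algebra.subset_adjoin ⟨i, Finset.ne_of_mem_erase hi, rfl⟩
    exact isIntegral_algebraMap (R := A) (A := R) (x := ⟨x i, hxi⟩)
  obtain ⟨q, hq, hq0⟩ := hint
  have htr : Polynomial.aeval (x i₀) q ≠ 0 := fun h ↦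
    hx.transcendental_adjoin (s := {i₀}ᶜ) (i := i₀) (by simp) ⟨q, hq.ne_zero, h⟩
  have hdvd := Polynomial.sub_dvd_eval_sub (algebraMap K R (x i₀)) (-n) (q.map (algebraMap A R))
  rw [Polynomial.eval_map_algebraMap, Polynomial.eval_map, hq0, sub_zero,
    Polynomial.aeval_algebraMap_apply, sub_neg_eq_add] at hdvd
  rw [← Finset.add_sum_erase _ _ (Finset.mem_univ i₀), hb₀, mul_one]
  exact isUnit_of_dvd_unit hdvd (htr.isUnit.map (algebraMap K R))

theorem Algebra.adjoin_le_of_mul_mem {F A : Type*} [CommSemiring F] [Semiring A] [Algebra F A]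
    {s : Set A} {W : Submodule F A} (h1 : 1 ∈ W) (hs : ∀ a ∈ s, ∀ w ∈ W, a * w ∈ W) :
    Subalgebra.toSubmodule (Algebra.adjoin F s) ≤ W := by
  have key (a : A) (ha : a ∈ Algebra.adjoin F s) : ∀ w ∈ W, a * w ∈ W := by
    induction ha using Algebra.adjoin_induction with
    | mem a ha => exact hs a ha
    | algebraMap r => exact fun w hw ↦ by rw [← Algebra.smul_def]; exact W.smul_mem r hw
    | add a b _ _ ha hb => exact fun w hw ↦ by rw [add_mul]; exact W.add_mem (ha w hw) (hb w hw)
    | mul a b _ _ ha hb => exact fun w hw ↦ by rw [mul_assoc]; exact ha _ (hb w hw)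
  exact fun a ha ↦ mul_one a ▸ key a ha 1 h1

/-- An integral subalgebra over a field contains the inverses of those of its elements which are
units of the ambient ring. -/
theorem Subalgebra.inv_mem_of_units {F A : Type*} [Field F] [CommRing A] [Algebra F A]
    (S : Subalgebra F A) [Algebra.IsIntegral F S] {u : Aˣ} (hu : (u : A) ∈ S) :
    ((u⁻¹ : Aˣ) : A) ∈ S := by
  have h : (⟨u, hu⟩ : S) ∈ nonZeroDivisors S := by
    rw [mem_nonZeroDivisors_iff_right]
    intro z hz
    have : (z : A) * u = 0 := congrArg Subtype.val hz
    exact Subtype.ext ((Units.mul_left_eq_zero u).mp this)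
  obtain ⟨v, hv⟩ := (IsArtinianRing.isUnit_iff_nonZeroDivisor_of_isIntegral'
    (R := F)).mpr h |>.exists_right_inv
  have hv' : (u : A) * v = 1 := congrArg Subtype.val hv
  rw [Units.inv_eq_of_mul_eq_one_right hv']
  exact v.2

/-- A subalgebra of `R` which is integral over `F`, and contains generators of the field `K` over
`k` and of the algebra `R` over `K`, is everything. -/
theorem Subalgebra.eq_top_of_field_generators_mem {k K R : Type*} [Field k] [Field K] [CommRing R]
    [Algebra k K] [Algebra K R] [FaithfulSMul K R] {F : IntermediateField k K}
    (S : Subalgebra F R) [Algebra.IsIntegral F S] {s : Set K} (hs : adjoin k s = ⊤)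
    {t : Set R} (ht : Algebra.adjoin K t = ⊤) (hsS : ∀ z ∈ s, algebraMap K R z ∈ S)
    (htS : t ⊆ S) : S = ⊤ := by
  have hint (r : R) (hr : r ∈ S) : IsIntegral F r :=
    (Algebra.IsIntegral.isIntegral (R := F) (⟨r, hr⟩ : S)).map S.val
  have hK (z : K) : algebraMap K R z ∈ S := by
    let C : Subalgebra F K := S.comap (IsScalarTower.toAlgHom F K R)
    have hC (z : K) (hz : z ∈ C) : z⁻¹ ∈ C := by
      refine C.inv_mem_of_algebraic (x := ⟨z, hz⟩) (IsIntegral.isAlgebraic ?_)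
      exact (isIntegral_algHom_iff (IsScalarTower.toAlgHom F K R)
        (FaithfulSMul.algebraMap_injective K R)).mp (hint _ hz)
    have hle : (⊤ : IntermediateField k K) ≤ (C.toIntermediateField hC).restrictScalars k := by
      rw [← hs, adjoin_le_iff]
      exact hsS
    exact hle (mem_top (x := z))
  refine eq_top_iff.mpr fun r _ ↦ ?_
  have hr : r ∈ Algebra.adjoin K t := ht ▸ Algebra.mem_top
  induction hr using Algebra.adjoin_induction with
  | mem r hr => exact htS hr
  | algebraMap z => exact hK z
  | add a b _ _ ha hb => exact S.add_mem (ha trivial) (hb trivial)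
  | mul a b _ _ ha hb => exact S.mul_mem (ha trivial) (hb trivial)

/-- In characteristic `p`, the fixed field of the cyclic shift of `p` variables is rational. -/
theorem isRationalExtension_fixedField_of_charP
    {k K : Type*} [Field k] [Field K] [Algebra k K] {p : ℕ} [Fact p.Prime] [CharP K p]
    {x : ZMod p → K} (hx : AlgebraicIndependent k x) (hgen : adjoin k (Set.range x) = ⊤)
    {σ : K ≃ₐ[k] K} (hσ : ∀ i, σ (x i) = x (i + 1)) :
    IsRationalExtension k (fixedField (Subgroup.zpowers σ)) := by
  let c : ZMod p →+* K := ZMod.castHom dvd_rfl K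
  set s₀ := ∑ i, x i with hs₀
  set s₁ := ∑ i, c i * x i with hs₁
  have hs₀0 : s₀ ≠ 0 := by
    have := hx.isUnit_sum (b := fun _ ↦ (1 : K)) (fun _ ↦ isIntegral_one) (i₀ := 0) rfl
    simpa using this.ne_zero
  set t := -s₁ / s₀ with ht
  have hσ₀ : σ s₀ = s₀ := by
    rw [hs₀, map_sum]
    simp_rw [hσ]
    exact Equiv.sum_comp (Equiv.addRight (1 : ZMod p)) x
  have hσc (i : ZMod p) : σ (c i) = c i := by
    have : (σ : K →+* K).comp c = c := Subsingleton.elim _ _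
    exact congrArg (· i) this
  have hσ₁ : σ s₁ = s₁ - s₀ := by
    rw [hs₁, hs₀, ← Finset.sum_sub_distrib, map_sum,
      ← Equiv.sum_comp (Equiv.addRight (1 : ZMod p)) (fun i ↦ c i * x i - x i)]
    refine Finset.sum_congr rfl fun i _ ↦ ?_
    simp only [map_mul, hσc, hσ, Equiv.coe_addRight, map_add, map_one]
    ring
  have hσt : σ t = t + 1 := by
    rw [ht, map_div₀, map_neg, hσ₀, hσ₁]
    field_simp
    ring
  let W (m : ℕ) : K := ∑ i, (t + c i) ^ m * x i
  have hσW (m : ℕ) : σ (W m) = W m := by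
    change σ (∑ i, _) = ∑ i, _
    rw [map_sum, ← Equiv.sum_comp (Equiv.addRight (1 : ZMod p)) (fun i ↦ (t + c i) ^ m * x i)]
    refine Finset.sum_congr rfl fun i _ ↦ ?_
    simp only [map_mul, map_pow, hσc, hσ, hσt, Equiv.coe_addRight, map_add, map_one]
    ring
  have hW₁ : W 1 = 0 := by
    change ∑ i, _ = (0 : K)
    simp_rw [pow_one, add_mul, Finset.sum_add_distrib, ← Finset.mul_sum]
    rw [← hs₀, ← hs₁, ht]
    field_simp
    ring
  let w (j : ZMod p) : K := if j = 1 then t ^ p - t else W j.val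
  have hw (j : ZMod p) : σ (w j) = w j := by
    by_cases hj : j = 1
    · simp only [w, hj, if_true, map_sub, map_pow, hσt, add_pow_char]
      ring
    · simp only [w, hj, if_false, hσW]
  set F := adjoin k (Set.range w) with hF
  have hwF (j : ZMod p) : w j ∈ F := subset_adjoin k _ ⟨j, rfl⟩
  have hWF (m : ℕ) (hm : m < p) : W m ∈ F := by
    by_cases hm1 : m = 1
    · rw [hm1, hW₁]
      exact F.zero_mem
    · have hmv : (m : ZMod p).val = m := ZMod.val_natCast_of_lt hm
      have hne : (m : ZMod p) ≠ 1 := fun h ↦ hm1 <| by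
        rw [← hmv, h, ZMod.val_one]
      simpa only [w, hne, if_false, hmv] using hwF m
  have hp : p - 1 + 1 = p := Nat.sub_add_cancel (Fact.out : p.Prime).one_le
  have hxW (i : ZMod p) : x i =
      W 0 - ∑ m ∈ Finset.range p, (-(t + c i)) ^ (p - 1 - m) * ((p - 1).choose m : K) * W m := by
    have hsum : ∑ m ∈ Finset.range p,
        (-(t + c i)) ^ (p - 1 - m) * ((p - 1).choose m : K) * W m =
        ∑ l, (c (l - i)) ^ (p - 1) * x l := by
      change ∑ m ∈ Finset.range p, _ * ∑ l, _ = _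
      simp_rw [Finset.mul_sum]
      rw [Finset.sum_comm]
      refine Finset.sum_congr rfl fun l _ ↦ ?_
      have : c (l - i) = (t + c l) + -(t + c i) := by rw [map_sub]; ring
      rw [this, add_pow, hp, Finset.sum_mul]
      exact Finset.sum_congr rfl fun m _ ↦ by ring
    change _ = ∑ l, _ - _
    rw [hsum, ← Finset.sum_sub_distrib, Finset.sum_eq_single i]
    · have : p - 1 ≠ 0 := Nat.sub_ne_zero_of_lt (Fact.out : p.Prime).one_lt
      rw [sub_self, map_zero, zero_pow this]
      ring
    · intro l _ hl
      rw [← map_pow, ZMod.pow_card_sub_one_eq_one (sub_ne_zero.mpr hl), map_one]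
      ring
    · exact fun h ↦ absurd (Finset.mem_univ i) h
  have htF : t ^ p - t ∈ F := by simpa [w] using hwF 1
  let q : Polynomial F := Polynomial.X ^ p - (Polynomial.X + Polynomial.C ⟨t ^ p - t, htF⟩)
  have hqdeg : (Polynomial.X + Polynomial.C (⟨t ^ p - t, htF⟩ : F)).degree < (p : WithBot ℕ) := by
    rw [Polynomial.degree_X_add_C]
    exact_mod_cast (Fact.out : p.Prime).one_lt
  have hq : q.Monic := Polynomial.monic_X_pow_sub hqdeg
  have hqt : Polynomial.aeval t q = 0 := by
    simp only [q, map_sub, map_add, map_pow, Polynomial.aeval_X, Polynomial.aeval_C,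
      IntermediateField.algebraMap_apply]
    ring
  have hint : IsIntegral F t := ⟨q, hq, hqt⟩
  have htop : F⟮t⟯ = ⊤ := by
    have hle : (⊤ : IntermediateField k K) ≤ F⟮t⟯.restrictScalars k := by
      rw [← hgen, adjoin_le_iff]
      rintro _ ⟨i, rfl⟩
      have htm : t ∈ F⟮t⟯ := mem_adjoin_simple_self F t
      have hW (m : ℕ) (hm : m < p) : W m ∈ F⟮t⟯ := F⟮t⟯.algebraMap_mem ⟨W m, hWF m hm⟩
      have hc : c i ∈ F⟮t⟯ := by
        rw [← ZMod.natCast_zmod_val i, map_natCast]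
        exact _root_.natCast_mem _ _
      change x i ∈ F⟮t⟯
      rw [hxW]
      exact sub_mem (hW 0 (Fact.out : p.Prime).pos) <| sum_mem fun m hm ↦
        mul_mem (mul_mem (pow_mem (neg_mem (add_mem htm hc)) _) (_root_.natCast_mem _ _))
          (hW m (Finset.mem_range.mp hm))
    exact eq_top_iff.mpr fun z _ ↦ hle (mem_top (x := z))
  have hfin : FiniteDimensional F K := by
    have := adjoin.finiteDimensional hint
    rw [htop] at this
    exact (topEquiv (F := F) (E := K)).toLinearEquiv.finiteDimensional
  refine isRationalExtension_fixedField_of_finrank_lt hx hgen hσ hw ?_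
  have hrank : finrank F K = (minpoly F t).natDegree := by
    rw [← adjoin.finrank hint, htop, finrank_top']
  have hmin := Polynomial.natDegree_le_of_dvd (minpoly.dvd F t hqt) hq.ne_zero
  have hqn : q.natDegree = p := by
    rw [Polynomial.natDegree_sub_eq_left_of_natDegree_lt, Polynomial.natDegree_X_pow]
    rw [Polynomial.natDegree_X_add_C, Polynomial.natDegree_X_pow]
    exact (Fact.out : p.Prime).one_lt
  have := (Fact.out : p.Prime).pos
  rw [← hF, hrank]
  omega

theorem AddChar.sum_apply_mul_eq_ite {R : Type*} [CommRing R] {p : ℕ} [Fact p.Prime]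
    {e : AddChar (ZMod p) R} (he : ∑ i, e i = 0) (c : ZMod p) :
    ∑ a, e (a * c) = if c = 0 then (p : R) else 0 := by
  split_ifs with hc
  · simp [hc]
  · rw [← he]
    exact Equiv.sum_comp (Equiv.mulRight₀ c hc) e

/-- Fourier inversion on `ZMod p`. -/
theorem AddChar.sum_apply_neg_mul_sum {R : Type*} [CommRing R] {p : ℕ} [Fact p.Prime]
    {e : AddChar (ZMod p) R} (he : ∑ i, e i = 0) (u : ZMod p → R) (i : ZMod p) :
    ∑ a, e (-(a * i)) * ∑ j, u j * e (a * j) = p * u i := by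
  have (a : ZMod p) : e (-(a * i)) * ∑ j, u j * e (a * j) = ∑ j, u j * e (a * (j - i)) := by
    rw [Finset.mul_sum]
    refine Finset.sum_congr rfl fun j _ ↦ ?_
    rw [mul_left_comm, ← e.map_add_eq_mul, mul_sub, neg_add_eq_sub]
  simp_rw [this]
  rw [Finset.sum_comm]
  simp_rw [← Finset.mul_sum, sum_apply_mul_eq_ite he, sub_eq_zero]
  simp [mul_comm]

section CommGroup

variable {G : Type*} [CommGroup G] {y z : ZMod 7 → G}

theorem sq_mul_apply_of_eq_mul_div (hz : ∀ a, z a = y a * y (3 * a) / y (4 * a)) (b : ZMod 7) :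
    y b ^ 2 * y (5 * b) = z (5 * b) * z b * z (6 * b) := by
  rw [hz, hz b, hz (6 * b)]
  have h (m n : ZMod 7) (l : ZMod 7) (hl : m * n = l) : m * (n * b) = l * b := by
    rw [← mul_assoc, hl]
  rw [h 3 5 1 (by decide), h 4 5 6 (by decide), h 3 6 4 (by decide), h 4 6 3 (by decide), one_mul]
  apply Additive.ofMul.injective
  simp only [ofMul_mul, ofMul_div, ofMul_pow]
  abel

theorem mul_apply_six_of_eq_mul_div (hz : ∀ a, z a = y a * y (3 * a) / y (4 * a)) :
    y 1 * y 6 = z 1 * z 6 := by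
  have h₁ : z 1 = y 1 * y 3 / y 4 := hz 1
  have h₆ : z 6 = y 6 * y 4 / y 3 := hz 6
  rw [h₁, h₆]
  apply Additive.ofMul.injective
  simp only [ofMul_mul, ofMul_div]
  abel

/-- The monomials `y a * y (3 * a) / y (4 * a)` and `y 1` generate all the `y a`. -/
theorem apply_mem_of_eq_mul_div (hz : ∀ a, z a = y a * y (3 * a) / y (4 * a)) {H : Subgroup G}
    (hzH : ∀ a, z a ∈ H) (hy : y 1 ∈ H) (a : ZMod 7) : y a ∈ H := by
  have step {b : ZMod 7} (hb : y b ∈ H) : y (5 * b) ∈ H := by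
    rw [← H.mul_mem_cancel_left (H.pow_mem hb 2), sq_mul_apply_of_eq_mul_div hz]
    exact H.mul_mem (H.mul_mem (hzH _) (hzH _)) (hzH _)
  have h₀ : y 0 ∈ H := by
    have : z 0 = y 0 := by rw [hz, mul_zero, mul_zero, mul_div_cancel_right]
    exact this ▸ hzH 0
  have h₅ : y 5 ∈ H := step hy
  have h₄ : y 4 ∈ H := step h₅
  have h₆ : y 6 ∈ H := step h₄
  have h₂ : y 2 ∈ H := step h₆
  have h₃ : y 3 ∈ H := step h₂
  fin_cases a
  exacts [h₀, hy, h₂, h₃, h₄, h₅, h₆]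

theorem pow_seven_mem_of_eq_mul_div (hz : ∀ a, z a = y a * y (3 * a) / y (4 * a)) {H : Subgroup G}
    (hzH : ∀ a, z a ∈ H) : y 1 ^ 7 ∈ H := by
  have hsq (b : ZMod 7) : y b ^ 2 * y (5 * b) ∈ H := by
    rw [sq_mul_apply_of_eq_mul_div hz]
    exact H.mul_mem (H.mul_mem (hzH _) (hzH _)) (hzH _)
  have h₁ : y 1 ^ 2 * y 5 ∈ H := hsq 1
  have h₅ : y 5 ^ 2 * y 4 ∈ H := hsq 5
  have h₄ : y 4 ^ 2 * y 6 ∈ H := hsq 4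
  have h₆ : y 1 * y 6 ∈ H := by
    rw [mul_apply_six_of_eq_mul_div hz]
    exact H.mul_mem (hzH _) (hzH _)
  have : y 1 ^ 7 = (y 4 ^ 2 * y 6) * (y 1 ^ 2 * y 5) ^ 4 / (y 1 * y 6) / (y 5 ^ 2 * y 4) ^ 2 := by
    apply Additive.ofMul.injective
    simp only [ofMul_mul, ofMul_div, ofMul_pow]
    abel
  rw [this]
  exact H.div_mem (H.div_mem (H.mul_mem h₄ (H.pow_mem h₁ 4)) h₆) (H.pow_mem h₅ 2)

end CommGroup

theorem Subalgebra.mem_units_iff_of_isIntegral {F A : Type*} [Field F] [CommRing A] [Algebra F A]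
    {S : Subalgebra F A} [Algebra.IsIntegral F S] {u : Aˣ} :
    u ∈ S.toSubmonoid.units ↔ (u : A) ∈ S :=
  ⟨fun h ↦ h.1, fun h ↦ ⟨h, S.inv_mem_of_units h⟩⟩

theorem AddChar.adjoin_range_le_span {F R G : Type*} [CommSemiring F] [Semiring R] [Algebra F R]
    [AddMonoid G] (e : AddChar G R) :
    Subalgebra.toSubmodule (Algebra.adjoin F (Set.range e)) ≤ Submodule.span F (Set.range e) := by
  refine Algebra.adjoin_le_of_mul_mem
    (e.map_zero_eq_one ▸ Submodule.subset_span ⟨0, rfl⟩) ?_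
  rintro _ ⟨i, rfl⟩ w hw
  induction hw using Submodule.span_induction with
  | mem w hw =>
    obtain ⟨j, rfl⟩ := hw
    exact Submodule.subset_span ⟨i + j, e.map_add_eq_mul i j⟩
  | zero => rw [mul_zero]; exact zero_mem _
  | add a b _ _ ha hb => rw [mul_add]; exact add_mem ha hb
  | smul c a _ ha => rw [mul_smul_comm]; exact Submodule.smul_mem _ _ ha

theorem AddChar.adjoin_insert_range_le_span {F R G : Type*} [CommSemiring F] [CommSemiring R]
    [Algebra F R] [AddMonoid G] (e : AddChar G R) {θ : R} {n : ℕ} [NeZero n]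
    (hθ : θ ^ n ∈ Submodule.span F (Set.range e)) :
    Subalgebra.toSubmodule (Algebra.adjoin F (insert θ (Set.range e))) ≤
      Submodule.span F (Set.range fun ij : G × Fin n ↦ e ij.1 * θ ^ (ij.2 : ℕ)) := by
  set W := Submodule.span F (Set.range fun ij : G × Fin n ↦ e ij.1 * θ ^ (ij.2 : ℕ)) with hW
  have hmem (i : G) (j : Fin n) : e i * θ ^ (j : ℕ) ∈ W := Submodule.subset_span ⟨(i, j), rfl⟩
  have hspan {a : R} (ha : ∀ i j, a * (e i * θ ^ ((j : Fin n) : ℕ)) ∈ W) (w : R) (hw : w ∈ W) :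
      a * w ∈ W := by
    induction hw using Submodule.span_induction with
    | mem w hw =>
      obtain ⟨⟨i, j⟩, rfl⟩ := hw
      exact ha i j
    | zero => rw [mul_zero]; exact zero_mem _
    | add a b _ _ ha hb => rw [mul_add]; exact add_mem ha hb
    | smul c a _ ha => rw [mul_smul_comm]; exact Submodule.smul_mem _ _ ha
  refine Algebra.adjoin_le_of_mul_mem ?_ ?_
  · simpa using hmem 0 0
  rintro _ (rfl | ⟨l, rfl⟩)
  · refine hspan fun i j ↦ ?_
    rw [mul_left_comm, ← pow_succ']
    rcases Nat.lt_or_ge (j + 1) n with hj | hj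
    · exact hmem i ⟨j + 1, hj⟩
    · rw [le_antisymm j.2 hj]
      have hsub : Submodule.span F (Set.range e) ≤ W.comap (LinearMap.mulLeft F (e i)) := by
        rw [Submodule.span_le]
        rintro _ ⟨l, rfl⟩
        change e i * e l ∈ W
        rw [← e.map_add_eq_mul]
        simpa using hmem (i + l) 0
      exact hsub hθ
  · refine hspan fun i j ↦ ?_
    rw [← mul_assoc, ← e.map_add_eq_mul]
    exact hmem _ _

theorem fact_prime_seven : Fact (Nat.Prime 7) := ⟨by norm_num⟩

section PrimeSeven

attribute [local instance] fact_prime_seven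

/-- The degree estimate behind the rationality of the fixed field of the `7`-cycle: the Kummer-type
element `y 1` has degree at most `7` over the ring generated by the monomials `z a`. -/
theorem finrank_adjoin_le_eight_of_eq_mul_div {k K R : Type*} [Field k] [Field K] [CommRing R]
    [Algebra k K] [Algebra K R] [FaithfulSMul K R] (hR : finrank K R = 6) (h7 : (7 : K) ≠ 0)
    {e : AddChar (ZMod 7) R} (he : ∑ i, e i = 0) (hadj : Algebra.adjoin K (Set.range e) = ⊤)
    {x w : ZMod 7 → K} (hgen : adjoin k (Set.range x) = ⊤) {y z : ZMod 7 → Rˣ}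
    (hz : ∀ a, z a = y a * y (3 * a) / y (4 * a))
    (hy : ∀ a, (y a : R) = ∑ j, algebraMap K R (x j) * e (a * j))
    (hw : ∀ a, 7 * (z a : R) = ∑ j, e (-(j * a)) * algebraMap K R (w j)) :
    FiniteDimensional (adjoin k (Set.range w)) K ∧ finrank (adjoin k (Set.range w)) K ≤ 8 := by
  set F := adjoin k (Set.range w) with hF
  have h7F : (7 : F) ≠ 0 := fun h ↦ h7 (congrArg Subtype.val h)
  have div7 (S : Subalgebra F R) {r : R} (hr : 7 * r ∈ S) : r ∈ S := by
    have : r = (7 : F)⁻¹ • (7 * r) := by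
      rw [← map_ofNat (algebraMap F R) 7, ← Algebra.smul_def, smul_smul, inv_mul_cancel₀ h7F,
        one_smul]
    rw [this]
    exact S.smul_mem hr _
  have fin {S : Subalgebra F R} {t : Set R} (ht : t.Finite)
      (h : Subalgebra.toSubmodule S ≤ Submodule.span F t) : Algebra.IsIntegral F S := by
    have := FiniteDimensional.span_of_finite F ht
    have : Module.Finite F S := Submodule.finiteDimensional_of_le h
    infer_instance
  let B := Algebra.adjoin F (Set.range e)
  have hB : Subalgebra.toSubmodule B ≤ Submodule.span F (Set.range e) := e.adjoin_range_le_span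
  have : Algebra.IsIntegral F B := fin (Set.finite_range e) hB
  have hzB (a : ZMod 7) : (z a : R) ∈ B := by
    refine div7 B ?_
    rw [hw]
    refine sum_mem fun j _ ↦ B.mul_mem (Algebra.subset_adjoin ⟨_, rfl⟩) ?_
    exact B.algebraMap_mem ⟨w j, subset_adjoin k _ ⟨j, rfl⟩⟩
  have hθ : (y 1 : R) ^ 7 ∈ B := by
    rw [← Units.val_pow_eq_pow_val, ← Subalgebra.mem_units_iff_of_isIntegral]
    exact pow_seven_mem_of_eq_mul_div hz fun a ↦ Subalgebra.mem_units_iff_of_isIntegral.mpr (hzB a)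
  let A := Algebra.adjoin F (insert (y 1 : R) (Set.range e))
  have hA := e.adjoin_insert_range_le_span (hB hθ)
  have : Algebra.IsIntegral F A := fin (Set.finite_range _) hA
  have heA (i : ZMod 7) : e i ∈ A := Algebra.subset_adjoin (.inr ⟨i, rfl⟩)
  have hBA : B ≤ A := Algebra.adjoin_mono (Set.subset_insert _ _)
  have hyA (a : ZMod 7) : (y a : R) ∈ A := by
    rw [← Subalgebra.mem_units_iff_of_isIntegral]
    refine apply_mem_of_eq_mul_div hz
      (fun a ↦ Subalgebra.mem_units_iff_of_isIntegral.mpr (hBA (hzB a))) ?_ a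
    exact Subalgebra.mem_units_iff_of_isIntegral.mpr (Algebra.subset_adjoin (.inl rfl))
  have hxA (i : ZMod 7) : algebraMap K R (x i) ∈ A := by
    refine div7 A ?_
    have := AddChar.sum_apply_neg_mul_sum he (fun j ↦ algebraMap K R (x j)) i
    rw [Nat.cast_ofNat] at this
    rw [← this]
    refine sum_mem fun a _ ↦ A.mul_mem (heA _) ?_
    rw [← hy]
    exact hyA a
  have htop : A = ⊤ := A.eq_top_of_field_generators_mem hgen hadj
    (Set.forall_mem_range.mpr hxA) (Set.range_subset_iff.mpr heA)
  have hspan : Submodule.span F (Set.range fun ij : ZMod 7 × Fin 7 ↦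
      e ij.1 * (y 1 : R) ^ (ij.2 : ℕ)) = ⊤ := by
    rw [eq_top_iff, ← Algebra.top_toSubmodule, ← htop]
    exact hA
  have hfin : Module.Finite F R :=
    Module.finite_def.mpr (hspan ▸ Submodule.fg_span (Set.finite_range _))
  have hFK : FiniteDimensional F K := Module.Finite.of_injective
    (IsScalarTower.toAlgHom F K R).toLinearMap (FaithfulSMul.algebraMap_injective K R)
  refine ⟨hFK, ?_⟩
  have hle : finrank F R ≤ 49 := by
    rw [← finrank_top F R, ← hspan]
    exact finrank_range_le_card _
  rw [← finrank_mul_finrank F K R, hR] at hle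
  omega

section CyclotomicRing

open Polynomial

variable (p : ℕ) (K : Type*) [Field K]

/-- The ring obtained from `K` by adjoining a root of the `p`-th cyclotomic polynomial, which need
not be irreducible. -/
abbrev CyclotomicQuotient : Type _ := AdjoinRoot (cyclotomic p K)

theorem CyclotomicQuotient.root_pow_eq_one :
    AdjoinRoot.root (cyclotomic p K) ^ p = 1 := by
  have h : AdjoinRoot.mk (cyclotomic p K) (X ^ p - 1) = 0 :=
    AdjoinRoot.mk_eq_zero.mpr (cyclotomic.dvd_X_pow_sub_one p K)
  simpa [sub_eq_zero] using h

variable [Fact p.Prime]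

theorem sum_range_natCast_zmod {M : Type*} [AddCommMonoid M] (f : ZMod p → M) :
    ∑ i ∈ Finset.range p, f i = ∑ i, f i :=
  Finset.sum_nbij' (fun i ↦ (i : ZMod p)) ZMod.val (by simp) (by simp [ZMod.val_lt])
    (fun i hi ↦ ZMod.val_cast_of_lt (Finset.mem_range.mp hi)) (by simp) (by simp)

/-- The character `i ↦ ζ ^ i`, where `ζ` is the adjoined root. -/
noncomputable def cyclotomicAddChar : AddChar (ZMod p) (CyclotomicQuotient p K) :=
  AddChar.zmodChar p (CyclotomicQuotient.root_pow_eq_one p K)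

theorem cyclotomicAddChar_natCast (n : ℕ) :
    cyclotomicAddChar p K n = AdjoinRoot.root (cyclotomic p K) ^ n :=
  AddChar.zmodChar_apply' _ n

theorem cyclotomicAddChar_one : cyclotomicAddChar p K 1 = AdjoinRoot.root (cyclotomic p K) := by
  simpa using cyclotomicAddChar_natCast p K 1

theorem sum_cyclotomicAddChar : ∑ i, cyclotomicAddChar p K i = 0 := by
  rw [← sum_range_natCast_zmod]
  simp_rw [cyclotomicAddChar_natCast]
  have h : AdjoinRoot.mk (cyclotomic p K) (∑ i ∈ Finset.range p, X ^ i) = 0 := by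
    rw [← cyclotomic_prime, AdjoinRoot.mk_self]
  simpa using h

theorem adjoin_range_cyclotomicAddChar :
    Algebra.adjoin K (Set.range (cyclotomicAddChar p K)) = ⊤ := by
  rw [eq_top_iff, ← AdjoinRoot.adjoinRoot_eq_top]
  exact Algebra.adjoin_mono (Set.singleton_subset_iff.mpr ⟨1, cyclotomicAddChar_one p K⟩)

theorem finrank_cyclotomicQuotient : finrank K (CyclotomicQuotient p K) = p - 1 := by
  rw [(AdjoinRoot.powerBasis' (cyclotomic.monic p K)).finrank, AdjoinRoot.powerBasis'_dim,
    natDegree_cyclotomic, Nat.totient_prime Fact.out]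

instance : Nontrivial (CyclotomicQuotient p K) :=
  AdjoinRoot.nontrivial _ (degree_cyclotomic_pos p K (Fact.out : p.Prime).pos).ne'

theorem exists_eq_sum_smul_cyclotomicAddChar (r : CyclotomicQuotient p K) :
    ∃ c : ZMod p → K, r = ∑ i, c i • cyclotomicAddChar p K i := by
  have hr : r ∈ Submodule.span K (Set.range (cyclotomicAddChar p K)) := by
    refine (cyclotomicAddChar p K).adjoin_range_le_span ?_
    rw [adjoin_range_cyclotomicAddChar]
    trivial
  obtain ⟨c, hc⟩ := (Submodule.mem_span_range_iff_exists_fun K).mp hr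
  exact ⟨c, hc.symm⟩

/-- The only linear relations between the powers of the adjoined root are the multiples of the
cyclotomic polynomial. -/
theorem eq_of_sum_smul_cyclotomicAddChar_eq_zero {c : ZMod p → K}
    (hc : ∑ i, c i • cyclotomicAddChar p K i = 0) (i j : ZMod p) : c i = c j := by
  have hp : p.Prime := Fact.out
  set d := c ((p - 1 : ℕ) : ZMod p) with hd
  suffices H : ∀ i, c i = d by rw [H, H]
  let q : K[X] := ∑ i ∈ Finset.range p, C (c i - d) * X ^ i
  have hcoeff (i : ℕ) (hi : i < p) : q.coeff i = c i - d := by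
    simp only [q, finsetSum_coeff, coeff_C_mul, coeff_X_pow]
    simp [hi]
  have hdeg : q.degree < (cyclotomic p K).degree := by
    rw [degree_cyclotomic, Nat.totient_prime hp, degree_lt_iff_coeff_zero]
    intro m hm
    rcases hm.eq_or_lt with rfl | hm
    · rw [hcoeff _ (by have := hp.pos; omega), sub_self]
    · have : ¬ m < p := by omega
      simp only [q, finsetSum_coeff, coeff_C_mul, coeff_X_pow]
      simp [this]
  have hdvd : cyclotomic p K ∣ q := by
    rw [← AdjoinRoot.mk_eq_zero]
    have : AdjoinRoot.mk (cyclotomic p K) q =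
        ∑ i, (c i - d) • cyclotomicAddChar p K i := by
      rw [← sum_range_natCast_zmod]
      simp [q, cyclotomicAddChar_natCast, Algebra.smul_def, AdjoinRoot.algebraMap_eq]
    rw [this]
    simp_rw [sub_smul]
    rw [Finset.sum_sub_distrib, hc, ← Finset.smul_sum, sum_cyclotomicAddChar, smul_zero, sub_zero]
  have hq := eq_zero_of_dvd_of_degree_lt hdvd hdeg
  intro i
  have := hcoeff i.val i.val_lt
  rw [hq, coeff_zero, ZMod.natCast_zmod_val] at this
  exact (sub_eq_zero.mp this.symm)

variable {p K}

theorem CyclotomicQuotient.exists_ringHom {S : Type*} [CommRing S] (f : K →+* S)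
    {e : AddChar (ZMod p) S} (he : ∑ i, e i = 0) :
    ∃ φ : CyclotomicQuotient p K →+* S, (∀ z, φ (algebraMap K _ z) = f z) ∧
      ∀ i, φ (cyclotomicAddChar p K i) = e i := by
  have hpow (n : ℕ) : e 1 ^ n = e n := by
    rw [← e.map_nsmul_eq_pow, nsmul_one]
  have h : (cyclotomic p K).eval₂ f (e 1) = 0 := by
    rw [cyclotomic_prime, eval₂_finsetSum, ← he, ← sum_range_natCast_zmod]
    simp [hpow]
  refine ⟨AdjoinRoot.lift f (e 1) h, fun z ↦ AdjoinRoot.lift_of h, fun i ↦ ?_⟩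
  rw [← ZMod.natCast_zmod_val i, cyclotomicAddChar_natCast, map_pow, AdjoinRoot.lift_root, hpow]

end CyclotomicRing

/-- An element of `K[ζ]` invariant under `ζ ↦ ζ ^ 3`, where `ζ` is a seventh root of unity, lies in
`K`. -/
theorem exists_algebraMap_eq_of_map_eq {K : Type*} [Field K]
    {τ : CyclotomicQuotient 7 K →+* CyclotomicQuotient 7 K}
    (hτ : ∀ z, τ (algebraMap K _ z) = algebraMap K _ z)
    (hτe : ∀ i, τ (cyclotomicAddChar 7 K i) = cyclotomicAddChar 7 K (3 * i))
    {r : CyclotomicQuotient 7 K} (hr : τ r = r) : ∃ z, algebraMap K _ z = r := by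
  obtain ⟨c, rfl⟩ := exists_eq_sum_smul_cyclotomicAddChar 7 K r
  have hτr : τ (∑ i, c i • cyclotomicAddChar 7 K i) =
      ∑ i, c (5 * i) • cyclotomicAddChar 7 K i := by
    rw [← Equiv.sum_comp (Equiv.mulLeft₀ (3 : ZMod 7) (by decide))
      fun i ↦ c (5 * i) • cyclotomicAddChar 7 K i]
    simp only [map_sum, Algebra.smul_def, map_mul, hτ, hτe, Equiv.mulLeft₀_apply, ← mul_assoc]
    refine Finset.sum_congr rfl fun i _ ↦ ?_
    rw [show (5 * 3 : ZMod 7) = 1 by decide, one_mul]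
  have hrel : ∑ i, (c (5 * i) - c i) • cyclotomicAddChar 7 K i = 0 := by
    simp_rw [sub_smul]
    rw [Finset.sum_sub_distrib, ← hτr, hr, sub_self]
  have hc (i : ZMod 7) : c (5 * i) = c i := by
    have := eq_of_sum_smul_cyclotomicAddChar_eq_zero 7 K hrel i 0
    rwa [mul_zero, sub_self, sub_eq_zero] at this
  have h₅ : c 5 = c 1 := hc 1
  have h₄ : c 4 = c 5 := hc 5
  have h₆ : c 6 = c 4 := hc 4
  have h₂ : c 2 = c 6 := hc 6
  have h₃ : c 3 = c 2 := hc 2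
  have hne (i : ZMod 7) (hi : i ≠ 0) : c i = c 1 := by
    fin_cases i
    exacts [absurd rfl hi, rfl, h₂.trans (h₆.trans (h₄.trans h₅)),
      h₃.trans (h₂.trans (h₆.trans (h₄.trans h₅))), h₄.trans h₅, h₅, h₆.trans (h₄.trans h₅)]
  have hi (i : ZMod 7) : c i = c 1 + if i = 0 then c 0 - c 1 else 0 := by
    split_ifs with h
    · rw [h, add_sub_cancel]
    · rw [hne i h, add_zero]
  have hsum : ∑ i, c i • cyclotomicAddChar 7 K i =
      ∑ i, (c 1 • cyclotomicAddChar 7 K i +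
        (if i = 0 then c 0 - c 1 else 0) • cyclotomicAddChar 7 K i) :=
    Finset.sum_congr rfl fun i _ ↦ by rw [← add_smul, ← hi]
  refine ⟨c 0 - c 1, ?_⟩
  rw [hsum, Finset.sum_add_distrib, ← Finset.smul_sum, sum_cyclotomicAddChar]
  simp only [ite_smul, zero_smul, Finset.sum_ite_eq', Finset.mem_univ, if_true,
    smul_zero, zero_add, AddChar.map_zero_eq_one, Algebra.algebraMap_eq_smul_one]

theorem isRationalExtension_fixedField_of_seven_ne_zero
    {k K : Type*} [Field k] [Field K] [Algebra k K] (h7 : (7 : K) ≠ 0)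
    {x : ZMod 7 → K} (hx : AlgebraicIndependent k x) (hgen : adjoin k (Set.range x) = ⊤)
    {σ : K ≃ₐ[k] K} (hσ : ∀ i, σ (x i) = x (i + 1)) :
    IsRationalExtension k (fixedField (Subgroup.zpowers σ)) := by
  let R := CyclotomicQuotient 7 K
  let e : AddChar (ZMod 7) R := cyclotomicAddChar 7 K
  have he : ∑ i, e i = 0 := sum_cyclotomicAddChar 7 K
  have he3 : ∑ i, e.mulShift 3 i = 0 := by
    simp_rw [AddChar.mulShift_apply, mul_comm (3 : ZMod 7)]
    rw [AddChar.sum_apply_mul_eq_ite he, if_neg (by decide)]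
  obtain ⟨τ, hτ, hτe⟩ : ∃ τ : R →+* R, (∀ z, τ (algebraMap K R z) = algebraMap K R z) ∧
      ∀ i, τ (e i) = e (3 * i) := CyclotomicQuotient.exists_ringHom (algebraMap K R) he3
  obtain ⟨s, hs, hse⟩ : ∃ s : R →+* R, (∀ z, s (algebraMap K R z) = algebraMap K R (σ z)) ∧
      ∀ i, s (e i) = e i :=
    CyclotomicQuotient.exists_ringHom ((algebraMap K R).comp (σ : K →+* K)) he
  have hint (i : ZMod 7) : IsIntegral k (e i) := by
    refine IsIntegral.of_pow (n := 7) (by norm_num) ?_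
    rw [← e.map_nsmul_eq_pow, ZModModule.char_nsmul_eq_zero, e.map_zero_eq_one]
    exact isIntegral_one
  have hunit (a : ZMod 7) : IsUnit (∑ j, algebraMap K R (x j) * e (a * j)) :=
    hx.isUnit_sum (fun _ ↦ hint _) (i₀ := 0) (by rw [mul_zero, e.map_zero_eq_one])
  choose y hy using hunit
  let z (a : ZMod 7) : Rˣ := y a * y (3 * a) / y (4 * a)
  have hτy (a : ZMod 7) : Units.map (τ : R →* R) (y a) = y (3 * a) := by
    ext
    simp [hy, hτ, hτe, mul_assoc]
  have hsy (a : ZMod 7) : s (y a) = e (-a) * y a := by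
    have : s (y a) = ∑ j, algebraMap K R (x (j + 1)) * e (a * j) := by
      rw [hy]
      simp [hs, hse, hσ]
    rw [this, hy, Finset.mul_sum, ← Equiv.sum_comp (Equiv.addRight 1)
      fun j ↦ e (-a) * (algebraMap K R (x j) * e (a * j))]
    refine Finset.sum_congr rfl fun j _ ↦ ?_
    rw [mul_left_comm, ← e.map_add_eq_mul, Equiv.coe_addRight, mul_add_one, neg_add_eq_sub,
      add_sub_cancel_right]
  have hτz (a : ZMod 7) : τ (z a) = z (3 * a) := by
    have : Units.map (τ : R →* R) (z a) = z (3 * a) := by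
      simp only [z, map_mul, map_div, hτy, mul_left_comm (3 : ZMod 7) 4]
    exact congrArg Units.val this
  have hsz (a : ZMod 7) : s (z a) = z a := by
    have hmul : z a * y (4 * a) = y a * y (3 * a) := div_mul_cancel _ _
    have hmul' : (z a * y (4 * a) : R) = y a * y (3 * a) := congrArg Units.val hmul
    have h := congrArg s hmul'
    have he4 : IsUnit (e (-(4 * a)) * y (4 * a)) := (e.val_isUnit _).mul (y (4 * a)).isUnit
    rw [map_mul, map_mul, hsy, hsy, hsy] at h
    refine he4.mul_left_injective (h.trans ?_)
    rw [mul_mul_mul_comm, ← e.map_add_eq_mul, ← hmul', mul_left_comm]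
    congr 3
    ring
  have hW (j : ZMod 7) : ∃ w, algebraMap K R w = ∑ a, z a * e (j * a) := by
    refine exists_algebraMap_eq_of_map_eq hτ hτe ?_
    refine Eq.trans ?_ <| Equiv.sum_comp (Equiv.mulLeft₀ (3 : ZMod 7) (by decide))
      fun a ↦ (z a : R) * e (j * a)
    simp [hτz, hτe, mul_left_comm]
  choose w hw using hW
  have hinj : Function.Injective (algebraMap K R) := FaithfulSMul.algebraMap_injective K R
  have hσw (j : ZMod 7) : σ (w j) = w j := by
    refine hinj ((hs (w j)).symm.trans ?_)
    rw [hw, map_sum]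
    exact Finset.sum_congr rfl fun a _ ↦ by rw [map_mul, hsz, hse]
  have hzw (a : ZMod 7) : 7 * (z a : R) = ∑ j, e (-(j * a)) * algebraMap K R (w j) := by
    simp_rw [hw]
    rw [AddChar.sum_apply_neg_mul_sum he fun a ↦ (z a : R)]
    rfl
  obtain ⟨hfin, hle⟩ := finrank_adjoin_le_eight_of_eq_mul_div (z := z)
    (finrank_cyclotomicQuotient 7 K) h7 he (adjoin_range_cyclotomicAddChar 7 K) hgen
    (fun _ ↦ rfl) hy hzw
  exact isRationalExtension_fixedField_of_finrank_lt hx hgen hσ hσw (by omega)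

end PrimeSeven

/-- The fixed field of the 7-cycle `x₀ ↦ x₁ ↦ ⋯ ↦ x₆ ↦ x₀` on the rational function
field in 7 variables is purely transcendental over any field `k`. -/
theorem cyclic_seven_fixed_field_rational
    (k K : Type*) [Field k] [Field K] [Algebra k K]
    (x : ZMod 7 → K) (hx : AlgebraicIndependent k x)
    (hgen : IntermediateField.adjoin k (Set.range x) = ⊤)
    (σ : K ≃ₐ[k] K) (hσ : ∀ i : ZMod 7, σ (x i) = x (i + 1)) :
    IsRationalExtension k (IntermediateField.fixedField (Subgroup.zpowers σ)) := by
  have := fact_prime_seven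
  by_cases h7 : (7 : K) = 0
  · have : CharP K 7 :=
      (CharP.charP_iff_prime_eq_zero Fact.out).mpr (by exact_mod_cast h7)
    exact isRationalExtension_fixedField_of_charP hx hgen hσ
  · exact isRationalExtension_fixedField_of_seven_ne_zero h7 hx hgen hσ
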